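/- Let d be a positive integer and let Y be a d×d complex matrix. Then ∫_{U(d)} U* Y Uᵀ dμ(U) = Yᵀ / d, where U* denotes the conjugate transpose of U and Uᵀ, Yᵀ denote transposes. -/

import Mathlib

open MeasureTheory Matrix

noncomputable instance {ι : Type*} [Fintype ι] [DecidableEq ι] :
    MeasurableSpace (Matrix.unitaryGroup ι ℂ) := borel _

instance {ι : Type*} [Fintype ι] [DecidableEq ι] :
    BorelSpace (Matrix.unitaryGroup ι ℂ) := ⟨rfl⟩

theorem aux_cont (d : ℕ) (i a : Fin d) :
    Continuous (fun U : Matrix.unitaryGroup (Fin d) ℂ => (U : Matrix (Fin d) (Fin d) ℂ) i a) :=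
  (continuous_subtype_val).matrix_elem i a

theorem aux_int (d : ℕ) (μ : Measure (Matrix.unitaryGroup (Fin d) ℂ))
    [IsProbabilityMeasure μ] (i a b j : Fin d) :
    Integrable (fun U : Matrix.unitaryGroup (Fin d) ℂ =>
      star ((U : Matrix (Fin d) (Fin d) ℂ) i a) * (U : Matrix (Fin d) (Fin d) ℂ) b j) μ := by
  refine Integrable.of_bound (C := 1) ?_ ?_
  · exact ((aux_cont d i a).star.mul (aux_cont d b j)).aestronglyMeasurable
  · refine Filter.Eventually.of_forall fun U => ?_
    rw [norm_mul, norm_star]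
    exact mul_le_one₀ (entry_norm_bound_of_unitary U.2 i a) (norm_nonneg _)
      (entry_norm_bound_of_unitary U.2 b j)

theorem aux_off (d : ℕ) (μ : Measure (Matrix.unitaryGroup (Fin d) ℂ))
    [μ.IsHaarMeasure] (i a b j : Fin d) (h : i ≠ b) :
    ∫ U : Matrix.unitaryGroup (Fin d) ℂ,
      star ((U : Matrix (Fin d) (Fin d) ℂ) i a) * (U : Matrix (Fin d) (Fin d) ℂ) b j ∂μ = 0 := by
  let D : Matrix (Fin d) (Fin d) ℂ := Matrix.diagonal (fun k => if k = i then -1 else 1)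
  have hD : D ∈ Matrix.unitaryGroup (Fin d) ℂ := by
    rw [Matrix.mem_unitaryGroup_iff, Matrix.star_eq_conjTranspose, Matrix.diagonal_conjTranspose,
      Matrix.diagonal_mul_diagonal, ← Matrix.diagonal_one]
    congr 1
    ext k
    by_cases hk : k = i <;> simp [hk]
  have key := integral_mul_left_eq_self (μ := μ) (fun U : Matrix.unitaryGroup (Fin d) ℂ =>
      star ((U : Matrix (Fin d) (Fin d) ℂ) i a) * (U : Matrix (Fin d) (Fin d) ℂ) b j) ⟨D, hD⟩
  simp only [Submonoid.coe_mul, D, Matrix.diagonal_mul, if_true, if_neg h.symm, one_mul, neg_mul,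
    star_neg, integral_neg] at key
  exact self_eq_neg.mp key.symm

theorem aux_swap (d : ℕ) (μ : Measure (Matrix.unitaryGroup (Fin d) ℂ))
    [μ.IsHaarMeasure] (i a b j : Fin d) :
    ∫ U : Matrix.unitaryGroup (Fin d) ℂ,
      star ((U : Matrix (Fin d) (Fin d) ℂ) i a) * (U : Matrix (Fin d) (Fin d) ℂ) i j ∂μ =
    ∫ U : Matrix.unitaryGroup (Fin d) ℂ,
      star ((U : Matrix (Fin d) (Fin d) ℂ) b a) * (U : Matrix (Fin d) (Fin d) ℂ) b j ∂μ := by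
  let P : Matrix (Fin d) (Fin d) ℂ := (1 : Matrix (Fin d) (Fin d) ℂ).submatrix (Equiv.swap i b) id
  have hP : P ∈ Matrix.unitaryGroup (Fin d) ℂ := by
    rw [Matrix.mem_unitaryGroup_iff, Matrix.star_eq_conjTranspose]
    ext x y
    simp [P, Matrix.mul_apply, Matrix.one_apply, eq_comm]
  have hPU : ∀ (U : Matrix (Fin d) (Fin d) ℂ) k, (P * U) b k = U i k := by
    intro U k
    simp [P, Matrix.mul_apply, Matrix.one_apply]
  have key := integral_mul_left_eq_self (μ := μ) (fun U : Matrix.unitaryGroup (Fin d) ℂ =>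
      star ((U : Matrix (Fin d) (Fin d) ℂ) b a) * (U : Matrix (Fin d) (Fin d) ℂ) b j) ⟨P, hP⟩
  simp only [Submonoid.coe_mul, hPU] at key
  exact key

theorem aux_diag (d : ℕ) (hd : 0 < d) (μ : Measure (Matrix.unitaryGroup (Fin d) ℂ))
    [μ.IsHaarMeasure] [IsProbabilityMeasure μ] (a b j : Fin d) :
    ∫ U : Matrix.unitaryGroup (Fin d) ℂ,
      star ((U : Matrix (Fin d) (Fin d) ℂ) b a) * (U : Matrix (Fin d) (Fin d) ℂ) b j ∂μ
      = (if a = j then 1 else 0) / (d : ℂ) := by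
  have hd' : (d : ℂ) ≠ 0 := by exact_mod_cast hd.ne'
  rw [eq_div_iff hd']
  have h1 : ∑ i : Fin d, ∫ U : Matrix.unitaryGroup (Fin d) ℂ,
      star ((U : Matrix (Fin d) (Fin d) ℂ) i a) * (U : Matrix (Fin d) (Fin d) ℂ) i j ∂μ
      = if a = j then 1 else 0 := by
    rw [← integral_finsetSum _ (fun i _ => aux_int d μ i a i j)]
    have : ∀ U : Matrix.unitaryGroup (Fin d) ℂ, ∑ i : Fin d,
        star ((U : Matrix (Fin d) (Fin d) ℂ) i a) * (U : Matrix (Fin d) (Fin d) ℂ) i j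
        = if a = j then 1 else 0 := by
      intro U
      have := congrFun (congrFun (Matrix.mem_unitaryGroup_iff'.mp U.2) a) j
      rw [Matrix.mul_apply, Matrix.one_apply] at this
      exact this
    simp only [this]
    simp
  rw [Finset.sum_congr rfl (fun i _ => aux_swap d μ i a b j)] at h1
  rw [← h1]
  simp [mul_comm]

/-- `∫_{U(d)} U* Y Uᵀ dμ(U) = Yᵀ / d`, the integral being taken entrywise. -/
theorem stmt_12 (d : ℕ) (hd : 0 < d)
    (μ : Measure (Matrix.unitaryGroup (Fin d) ℂ))
    [μ.IsHaarMeasure] [IsProbabilityMeasure μ]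
    (Y : Matrix (Fin d) (Fin d) ℂ) (a b : Fin d) :
    ∫ U : Matrix.unitaryGroup (Fin d) ℂ,
        ((U : Matrix (Fin d) (Fin d) ℂ)ᴴ * Y * (U : Matrix (Fin d) (Fin d) ℂ)ᵀ) a b ∂μ
      = Yᵀ a b / (d : ℂ) := by
  have h : ∀ U : Matrix.unitaryGroup (Fin d) ℂ,
      ((U : Matrix (Fin d) (Fin d) ℂ)ᴴ * Y * (U : Matrix (Fin d) (Fin d) ℂ)ᵀ) a b
      = ∑ j : Fin d, ∑ i : Fin d, Y i j *
        (star ((U : Matrix (Fin d) (Fin d) ℂ) i a) * (U : Matrix (Fin d) (Fin d) ℂ) b j) := by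
    intro U
    simp only [Matrix.mul_apply, Matrix.conjTranspose_apply, Matrix.transpose_apply,
      Finset.sum_mul]
    exact Finset.sum_congr rfl fun j _ => Finset.sum_congr rfl fun i _ => by ring
  simp only [h]
  rw [integral_finsetSum _ (fun j _ => integrable_finsetSum _
    (fun i _ => (aux_int d μ i a b j).const_mul _))]
  have h2 : ∀ j : Fin d, ∫ U : Matrix.unitaryGroup (Fin d) ℂ, ∑ i : Fin d, Y i j *
        (star ((U : Matrix (Fin d) (Fin d) ℂ) i a) * (U : Matrix (Fin d) (Fin d) ℂ) b j) ∂μ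
      = Y b j * ((if a = j then 1 else 0) / (d : ℂ)) := by
    intro j
    rw [integral_finsetSum _ (fun i _ => (aux_int d μ i a b j).const_mul _)]
    simp only [integral_const_mul]
    rw [Finset.sum_eq_single b, aux_diag d hd μ a b j]
    · intro i _ hi
      rw [aux_off d μ i a b j hi, mul_zero]
    · simp
  simp only [h2]
  rw [Finset.sum_eq_single a]
  · simp [div_eq_mul_inv]
  · intro j _ hj
    simp [hj.symm]
  · simp
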